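/- Let n ≤ d, and let a₁, β₁ ∈ ℝ, x, β ∈ ℝ^d, A ∈ ℝ^{n×d}, b ∈ ℝ^n be jointly independent random objects with [β; β₁] ~ N(0, ρ² I_{d+1}), the matrix [A, b] having linearly independent rows almost surely, E‖(AᵀA)⁺x‖² > 0, and the expectations E‖(A⁺)ᵀx‖², E[λ_max((AAᵀ)⁻¹)²], E[λ_max((AAᵀ)⁻¹)‖(A⁺)ᵀx‖²], E[λ_max((AAᵀ)⁻¹)²‖(A⁺)ᵀx‖²] all finite. Define 𝓔_d = (xᵀ(A⁺A − I)β)², 𝓔_{d+1} = ([xᵀ, a₁]([A,b]⁺[A,b] − I)[β; β₁])², L^exp_d = E[𝓔_d] + η² E‖(Aᵀ)⁺x‖², and L^exp_{d+1} = E[𝓔_{d+1}] + η² E‖[Aᵀ; bᵀ]⁺[x; a₁]‖². Then there exists σ > 0 such that if a₁, b₁, …, bₙ are i.i.d. N(0, σ²), then for all ρ ≤ η·√( E‖(AᵀA)⁺x‖² / (E‖(A⁺)ᵀx‖² + 1) ), one has L^exp_{d+1} < L^exp_d. -/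

import Mathlib

open MeasureTheory ProbabilityTheory Matrix
open scoped NNReal ENNReal

noncomputable section

/-- Squared Euclidean norm of a vector in `ℝ^n`. -/
def sqnorm {n : ℕ} (v : Fin n → ℝ) : ℝ := ∑ i, v i ^ 2

/-- Moore–Penrose pseudoinverse of a matrix with linearly independent rows:
`M⁺ = Mᵀ (M Mᵀ)⁻¹`. -/
def pinvRows {m n : ℕ} (M : Matrix (Fin m) (Fin n) ℝ) : Matrix (Fin n) (Fin m) ℝ :=
  Mᵀ * (M * Mᵀ)⁻¹

/-- Moore–Penrose pseudoinverse of a matrix with linearly independent columns: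
`M⁺ = (Mᵀ M)⁻¹ Mᵀ`. -/
def pinvCols {m n : ℕ} (M : Matrix (Fin m) (Fin n) ℝ) : Matrix (Fin n) (Fin m) ℝ :=
  (Mᵀ * M)⁻¹ * Mᵀ

/-- Append a row at the bottom of a matrix. -/
def appendRow {m n : ℕ} (M : Matrix (Fin m) (Fin n) ℝ) (r : Fin n → ℝ) :
    Matrix (Fin (m + 1)) (Fin n) ℝ := Matrix.of (Fin.snoc (fun i => M i) r)

/-- Append a column at the right of a matrix. -/
def appendCol {m n : ℕ} (M : Matrix (Fin m) (Fin n) ℝ) (c : Fin m → ℝ) :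
    Matrix (Fin m) (Fin (n + 1)) ℝ := Matrix.of (fun i => Fin.snoc (M i) (c i))

/-- Trimodal Gaussian mixture `N^mix_{σ,μ} = (1/3)N(0,σ²) + (1/3)N(-μ,σ²) + (1/3)N(μ,σ²)`. -/
def gmix (σ μ : ℝ) : Measure ℝ :=
  (3 : ℝ≥0∞)⁻¹ • gaussianReal 0 (σ ^ 2).toNNReal
    + (3 : ℝ≥0∞)⁻¹ • gaussianReal (-μ) (σ ^ 2).toNNReal
    + (3 : ℝ≥0∞)⁻¹ • gaussianReal μ (σ ^ 2).toNNReal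

instance (σ μ : ℝ) : IsProbabilityMeasure (gmix σ μ) := by
  constructor
  simp only [gmix, Measure.coe_add, Pi.add_apply, Measure.smul_apply, smul_eq_mul,
    measure_univ, mul_one]
  rw [show ((3 : ℝ≥0∞)⁻¹ + 3⁻¹ + 3⁻¹ : ℝ≥0∞) = 3 * 3⁻¹ by ring]
  exact ENNReal.mul_inv_cancel (by norm_num) (by norm_num)

/-- Matrices carry the product σ-algebra. -/
instance {m n : ℕ} : MeasurableSpace (Matrix (Fin m) (Fin n) ℝ) :=
  inferInstanceAs (MeasurableSpace (Fin m → Fin n → ℝ))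

/-- The joint law of the jointly independent random objects
`p = (a₁, β₁, x, β, A, b)`: the new feature entries `a₁` (test) and `b = (b₁,…,bₙ)`
(training) have common distribution `θ`, the coefficients `β₁ ∈ ℝ` and `β ∈ ℝ^d` are
i.i.d. `N(0,ρ²)` (so that `[β; β₁] ~ N(0, ρ² I_{d+1})`), `A` has law `μA` and `x` has
law `μx`. -/
def jointLaw (n d : ℕ) (ρ : ℝ) (θ : Measure ℝ) [SigmaFinite θ]
    (μA : Measure (Matrix (Fin n) (Fin d) ℝ)) (μx : Measure (Fin d → ℝ)) :
    Measure (ℝ × ℝ × (Fin d → ℝ) × (Fin d → ℝ) × Matrix (Fin n) (Fin d) ℝ × (Fin n → ℝ)) :=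
  θ.prod ((gaussianReal 0 (ρ ^ 2).toNNReal).prod (μx.prod
    ((Measure.pi fun _ : Fin d => gaussianReal 0 (ρ ^ 2).toNNReal).prod
      (μA.prod (Measure.pi fun _ : Fin n => θ)))))

/-- The expected risk `L^exp_d = E[𝓔_d] + η² E‖(Aᵀ)⁺x‖²`, with
`𝓔_d = (xᵀ(A⁺A − I)β)²`. -/
def LexpD (n d : ℕ) (η : ℝ)
    (μ : Measure (ℝ × ℝ × (Fin d → ℝ) × (Fin d → ℝ) × Matrix (Fin n) (Fin d) ℝ × (Fin n → ℝ))) : ℝ :=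
  (∫ p, (p.2.2.1 ⬝ᵥ ((pinvRows p.2.2.2.2.1 * p.2.2.2.2.1 - 1) *ᵥ p.2.2.2.1)) ^ 2 ∂μ)
    + η ^ 2 * ∫ p, sqnorm (pinvCols (p.2.2.2.2.1)ᵀ *ᵥ p.2.2.1) ∂μ

/-- The expected risk `L^exp_{d+1} = E[𝓔_{d+1}] + η² E‖[Aᵀ; bᵀ]⁺[x; a₁]‖²`, with
`𝓔_{d+1} = ([xᵀ, a₁]([A,b]⁺[A,b] − I)[β; β₁])²`. -/
def LexpD1 (n d : ℕ) (η : ℝ)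
    (μ : Measure (ℝ × ℝ × (Fin d → ℝ) × (Fin d → ℝ) × Matrix (Fin n) (Fin d) ℝ × (Fin n → ℝ))) : ℝ :=
  (∫ p, (Fin.snoc p.2.2.1 p.1 ⬝ᵥ
      ((pinvRows (appendCol p.2.2.2.2.1 p.2.2.2.2.2) * appendCol p.2.2.2.2.1 p.2.2.2.2.2 - 1) *ᵥ
        Fin.snoc p.2.2.2.1 p.2.1)) ^ 2 ∂μ)
    + η ^ 2 * ∫ p,
        sqnorm (pinvCols (appendRow (p.2.2.2.2.1)ᵀ p.2.2.2.2.2) *ᵥ Fin.snoc p.2.2.1 p.1) ∂μ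

/-- The largest eigenvalue of a (symmetric positive definite) matrix, as the supremum of
its set of eigenvalues. -/
def lambdaMax {n : ℕ} (M : Matrix (Fin n) (Fin n) ℝ) : ℝ :=
  sSup {t : ℝ | ∃ v : Fin n → ℝ, v ≠ 0 ∧ M *ᵥ v = t • v}

section LinearAlgebra

variable {m n d : ℕ}

/-- The transposed pseudoinverse of `A` applied to `x`. -/
def dualSol (A : Matrix (Fin n) (Fin d) ℝ) (x : Fin d → ℝ) : Fin n → ℝ :=
  (A * Aᵀ)⁻¹ *ᵥ (A *ᵥ x)

/-- The component of `x` orthogonal to the row space of `A`. -/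
def resid (A : Matrix (Fin n) (Fin d) ℝ) (x : Fin d → ℝ) : Fin d → ℝ :=
  x - Aᵀ *ᵥ dualSol A x

/-- The squared Frobenius norm. -/
def frobSq (M : Matrix (Fin m) (Fin n) ℝ) : ℝ := ∑ i, ∑ j, M i j ^ 2

lemma sqnorm_eq_dotProduct (v : Fin n → ℝ) : sqnorm v = v ⬝ᵥ v := by
  simp [sqnorm, dotProduct, pow_two]

lemma sqnorm_nonneg (v : Fin n → ℝ) : 0 ≤ sqnorm v :=
  Finset.sum_nonneg fun _ _ => sq_nonneg _

lemma frobSq_nonneg (M : Matrix (Fin m) (Fin n) ℝ) : 0 ≤ frobSq M :=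
  Finset.sum_nonneg fun _ _ => Finset.sum_nonneg fun _ _ => sq_nonneg _

lemma sqnorm_eq_zero {v : Fin n → ℝ} : sqnorm v = 0 ↔ v = 0 := by
  rw [sqnorm_eq_dotProduct, dotProduct_self_eq_zero]

lemma sqnorm_snoc (v : Fin n → ℝ) (a : ℝ) :
    sqnorm (Fin.snoc v a : Fin (n + 1) → ℝ) = sqnorm v + a ^ 2 := by
  simp [sqnorm, Fin.sum_univ_castSucc]

lemma sq_dotProduct_le (u v : Fin n → ℝ) : (u ⬝ᵥ v) ^ 2 ≤ sqnorm u * sqnorm v :=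
  Finset.sum_mul_sq_le_sq_mul_sq _ _ _

lemma sqnorm_mulVec_le (M : Matrix (Fin m) (Fin n) ℝ) (v : Fin n → ℝ) :
    sqnorm (M *ᵥ v) ≤ frobSq M * sqnorm v := by
  rw [frobSq, Finset.sum_mul]
  exact Finset.sum_le_sum fun i _ => sq_dotProduct_le (M i) v

lemma sqnorm_add_le (u v : Fin n → ℝ) : sqnorm (u + v) ≤ 2 * sqnorm u + 2 * sqnorm v := by
  simp only [sqnorm, Finset.mul_sum, ← Finset.sum_add_distrib, Pi.add_apply]
  exact Finset.sum_le_sum fun i _ => by nlinarith [sq_nonneg (u i - v i)]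

lemma sqnorm_le_resid (A : Matrix (Fin n) (Fin d) ℝ) (x : Fin d → ℝ) :
    sqnorm x ≤ 2 * sqnorm (resid A x) + 2 * frobSq Aᵀ * sqnorm (dualSol A x) := by
  have h := sqnorm_add_le (resid A x) (Aᵀ *ᵥ dualSol A x)
  have h2 := sqnorm_mulVec_le Aᵀ (dualSol A x)
  rw [resid, sub_add_cancel] at h
  rw [resid]
  linarith

lemma gram_isSymm (A : Matrix (Fin n) (Fin d) ℝ) : (A * Aᵀ)ᵀ = A * Aᵀ := by
  simp

lemma gram_inv_isSymm (A : Matrix (Fin n) (Fin d) ℝ) : ((A * Aᵀ)⁻¹)ᵀ = (A * Aᵀ)⁻¹ := by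
  rw [transpose_nonsing_inv, gram_isSymm]

lemma inv_mul_mul_inv (G : Matrix (Fin n) (Fin n) ℝ) : G⁻¹ * G * G⁻¹ = G⁻¹ := by
  by_cases h : IsUnit G.det
  · rw [nonsing_inv_mul _ h, one_mul]
  · simp [nonsing_inv_apply_not_isUnit _ h]

lemma dotProduct_pinvRows_mul_sub_one (A : Matrix (Fin n) (Fin d) ℝ) (x β : Fin d → ℝ) :
    x ⬝ᵥ ((pinvRows A * A - 1) *ᵥ β) = -(resid A x ⬝ᵥ β) := by
  have h : (pinvRows A * A)ᵀ = pinvRows A * A := by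
    simp only [pinvRows, transpose_mul, transpose_transpose, gram_inv_isSymm, Matrix.mul_assoc]
  have h2 : resid A x = -((pinvRows A * A - 1)ᵀ *ᵥ x) := by
    rw [transpose_sub, h, transpose_one, sub_mulVec, one_mulVec, neg_sub, resid, dualSol, pinvRows,
      mulVec_mulVec, mulVec_mulVec]
  rw [h2, neg_dotProduct, neg_neg, dotProduct_mulVec, mulVec_transpose]

lemma pinvCols_transpose_mulVec (A : Matrix (Fin n) (Fin d) ℝ) (x : Fin d → ℝ) :
    pinvCols Aᵀ *ᵥ x = dualSol A x := by
  simp [pinvCols, dualSol, mulVec_mulVec]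

lemma pinvRows_transpose_mulVec (A : Matrix (Fin n) (Fin d) ℝ) (x : Fin d → ℝ) :
    (pinvRows A)ᵀ *ᵥ x = dualSol A x := by
  rw [pinvRows, transpose_mul, gram_inv_isSymm, transpose_transpose, dualSol, mulVec_mulVec]

lemma appendRow_transpose (A : Matrix (Fin n) (Fin d) ℝ) (b : Fin n → ℝ) :
    appendRow Aᵀ b = (appendCol A b)ᵀ := by
  ext i j
  refine Fin.lastCases ?_ (fun i => ?_) i <;> simp [appendRow, appendCol]

lemma appendCol_mulVec_snoc (A : Matrix (Fin n) (Fin d) ℝ) (b : Fin n → ℝ) (x : Fin d → ℝ)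
    (a : ℝ) : appendCol A b *ᵥ (Fin.snoc x a : Fin (d + 1) → ℝ) = A *ᵥ x + a • b := by
  ext i
  simp [mulVec, dotProduct, appendCol, Fin.sum_univ_castSucc, mul_comm]

lemma appendCol_transpose_mulVec (A : Matrix (Fin n) (Fin d) ℝ) (b y : Fin n → ℝ) :
    (appendCol A b)ᵀ *ᵥ y = (Fin.snoc (Aᵀ *ᵥ y) (b ⬝ᵥ y) : Fin (d + 1) → ℝ) := by
  ext i
  refine Fin.lastCases ?_ (fun i => ?_) i <;> simp [mulVec, dotProduct, appendCol]

lemma snoc_sub_appendCol_transpose_mulVec (A : Matrix (Fin n) (Fin d) ℝ) (b y : Fin n → ℝ)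
    (x : Fin d → ℝ) (a : ℝ) :
    (Fin.snoc x a : Fin (d + 1) → ℝ) - (appendCol A b)ᵀ *ᵥ y
      = (Fin.snoc (x - Aᵀ *ᵥ y) (a - b ⬝ᵥ y) : Fin (d + 1) → ℝ) := by
  rw [appendCol_transpose_mulVec]
  ext i
  refine Fin.lastCases ?_ (fun i => ?_) i <;> simp

lemma appendCol_gram_mulVec (A : Matrix (Fin n) (Fin d) ℝ) (b v : Fin n → ℝ) :
    (appendCol A b * (appendCol A b)ᵀ) *ᵥ v = (A * Aᵀ) *ᵥ v + (b ⬝ᵥ v) • b := by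
  rw [← mulVec_mulVec, appendCol_transpose_mulVec, appendCol_mulVec_snoc, mulVec_mulVec]

lemma gram_isUnit_of_linearIndependent {M : Matrix (Fin n) (Fin d) ℝ}
    (h : LinearIndependent ℝ (fun i => M i)) : IsUnit (M * Mᵀ).det := by
  have := PosDef.mul_conjTranspose_self M (vecMul_injective_iff.2 h)
  simpa [conjTranspose_eq_transpose_of_trivial] using this.det_pos.ne'

lemma mulVec_dualSol {A : Matrix (Fin n) (Fin d) ℝ} (h : IsUnit (A * Aᵀ).det) (x : Fin d → ℝ) :
    (A * Aᵀ) *ᵥ dualSol A x = A *ᵥ x := by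
  rw [dualSol, mulVec_mulVec, mul_nonsing_inv _ h, one_mulVec]

lemma eq_dualSol {A : Matrix (Fin n) (Fin d) ℝ} (h : IsUnit (A * Aᵀ).det) {x : Fin d → ℝ}
    {w : Fin n → ℝ} (hw : (A * Aᵀ) *ᵥ w = A *ᵥ x) : dualSol A x = w := by
  rw [dualSol, ← hw, mulVec_mulVec, nonsing_inv_mul _ h, one_mulVec]

/-- The residual is the shortest vector of `x + range Aᵀ`. -/
lemma sqnorm_resid_le {A : Matrix (Fin n) (Fin d) ℝ} (h : IsUnit (A * Aᵀ).det) (x : Fin d → ℝ)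
    (y : Fin n → ℝ) : sqnorm (resid A x) ≤ sqnorm (x - Aᵀ *ᵥ y) := by
  have h0 : A *ᵥ resid A x = 0 := by
    rw [resid, mulVec_sub, mulVec_mulVec, mulVec_dualSol h, sub_self]
  have h1 : x - Aᵀ *ᵥ y = resid A x + Aᵀ *ᵥ (dualSol A x - y) := by
    rw [resid, mulVec_sub]; abel
  have h2 : resid A x ⬝ᵥ (Aᵀ *ᵥ (dualSol A x - y)) = 0 := by
    rw [dotProduct_mulVec, vecMul_transpose, h0, zero_dotProduct]
  have h3 := sqnorm_nonneg (Aᵀ *ᵥ (dualSol A x - y))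
  rw [sqnorm_eq_dotProduct] at h3
  rw [h1, sqnorm_eq_dotProduct, sqnorm_eq_dotProduct, add_dotProduct, dotProduct_add,
    dotProduct_add, dotProduct_comm (Aᵀ *ᵥ _) (resid A x), h2]
  linarith

lemma sqnorm_resid_appendCol_le {A : Matrix (Fin n) (Fin d) ℝ} {b : Fin n → ℝ}
    (h : IsUnit (appendCol A b * (appendCol A b)ᵀ).det) (x : Fin d → ℝ) (a : ℝ) :
    sqnorm (resid (appendCol A b) (Fin.snoc x a))
      ≤ sqnorm (resid A x) + (a - b ⬝ᵥ dualSol A x) ^ 2 := by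
  refine (sqnorm_resid_le h _ (dualSol A x)).trans_eq ?_
  rw [snoc_sub_appendCol_transpose_mulVec, sqnorm_snoc, resid]

lemma le_sqnorm_resid_appendCol {A : Matrix (Fin n) (Fin d) ℝ} (h : IsUnit (A * Aᵀ).det)
    (b : Fin n → ℝ) (x : Fin d → ℝ) (a : ℝ) :
    sqnorm (resid A x) ≤ sqnorm (resid (appendCol A b) (Fin.snoc x a)) := by
  rw [resid.eq_1 (appendCol A b), snoc_sub_appendCol_transpose_mulVec, sqnorm_snoc]
  exact (sqnorm_resid_le h x _).trans (le_add_of_nonneg_right (sq_nonneg _))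

lemma gram_inv_eq (A : Matrix (Fin n) (Fin d) ℝ) :
    (A * Aᵀ)⁻¹ = ((A * Aᵀ)⁻¹ * A) * ((A * Aᵀ)⁻¹ * A)ᵀ := by
  rw [transpose_mul, gram_inv_isSymm, ← Matrix.mul_assoc, Matrix.mul_assoc _ A, inv_mul_mul_inv]

lemma dotProduct_gram_inv_mulVec (A : Matrix (Fin n) (Fin d) ℝ) (b : Fin n → ℝ) :
    b ⬝ᵥ ((A * Aᵀ)⁻¹ *ᵥ b) = sqnorm (((A * Aᵀ)⁻¹ * A)ᵀ *ᵥ b) := by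
  conv_lhs => rw [gram_inv_eq, ← mulVec_mulVec, dotProduct_mulVec, ← mulVec_transpose]
  rw [sqnorm_eq_dotProduct]

lemma sqnorm_pinv_gram_mulVec (A : Matrix (Fin n) (Fin d) ℝ) (x : Fin d → ℝ) :
    sqnorm ((Aᵀ * ((A * Aᵀ)⁻¹ ^ 2) * A) *ᵥ x)
      = dualSol A x ⬝ᵥ ((A * Aᵀ)⁻¹ *ᵥ dualSol A x) := by
  rw [dotProduct_gram_inv_mulVec, transpose_mul, gram_inv_isSymm, dualSol, mulVec_mulVec,
    mulVec_mulVec, pow_two]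
  simp only [Matrix.mul_assoc]

lemma dualSol_appendCol {A : Matrix (Fin n) (Fin d) ℝ} (hA : IsUnit (A * Aᵀ).det) {b : Fin n → ℝ}
    (h : IsUnit (appendCol A b * (appendCol A b)ᵀ).det) (x : Fin d → ℝ) (a : ℝ) :
    dualSol (appendCol A b) (Fin.snoc x a) = dualSol A x
      + ((a - b ⬝ᵥ dualSol A x) / (1 + b ⬝ᵥ ((A * Aᵀ)⁻¹ *ᵥ b))) • ((A * Aᵀ)⁻¹ *ᵥ b) := by
  apply eq_dualSol h
  have hs : 0 < 1 + b ⬝ᵥ ((A * Aᵀ)⁻¹ *ᵥ b) := by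
    rw [dotProduct_gram_inv_mulVec]; linarith [sqnorm_nonneg (((A * Aᵀ)⁻¹ * A)ᵀ *ᵥ b)]
  rw [appendCol_gram_mulVec, appendCol_mulVec_snoc, mulVec_add, mulVec_smul, mulVec_dualSol hA,
    mulVec_mulVec _ (A * Aᵀ), mul_nonsing_inv _ hA, one_mulVec, dotProduct_add, dotProduct_smul,
    add_assoc, ← add_smul, smul_eq_mul]
  congr 2
  field_simp
  ring

/-- A vector in the left kernel of `A` determines the sensitivity of the augmented solution to
the new test entry. -/
lemma dualSol_appendCol_of_ker {A : Matrix (Fin n) (Fin d) ℝ} {b u : Fin n → ℝ} (hu0 : u ≠ 0)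
    (hu : (A * Aᵀ) *ᵥ u = 0) (h : IsUnit (appendCol A b * (appendCol A b)ᵀ).det) :
    sqnorm ((appendCol A b * (appendCol A b)ᵀ)⁻¹ *ᵥ b) = sqnorm u / (b ⬝ᵥ u) ^ 2 := by
  have h1 : (appendCol A b * (appendCol A b)ᵀ) *ᵥ u = (b ⬝ᵥ u) • b := by
    rw [appendCol_gram_mulVec, hu, zero_add]
  have h2 : u = (b ⬝ᵥ u) • ((appendCol A b * (appendCol A b)ᵀ)⁻¹ *ᵥ b) := by
    rw [← mulVec_smul, ← h1, mulVec_mulVec, nonsing_inv_mul _ h, one_mulVec]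
  have h3 : b ⬝ᵥ u ≠ 0 := fun h0 => hu0 (by rw [h2, h0, zero_smul])
  set k := (appendCol A b * (appendCol A b)ᵀ)⁻¹ *ᵥ b
  have h4 : sqnorm u = (b ⬝ᵥ u) ^ 2 * sqnorm k := by
    conv_lhs => rw [h2]
    simp [sqnorm, mul_pow, Finset.mul_sum]
  rw [h4]
  field_simp

lemma dualSol_appendCol_eq_add (A : Matrix (Fin n) (Fin d) ℝ) (b : Fin n → ℝ)
    (x : Fin d → ℝ) (a : ℝ) :
    dualSol (appendCol A b) (Fin.snoc x a) =
      (appendCol A b * (appendCol A b)ᵀ)⁻¹ *ᵥ (A *ᵥ x)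
        + a • ((appendCol A b * (appendCol A b)ᵀ)⁻¹ *ᵥ b) := by
  rw [dualSol, appendCol_mulVec_snoc, mulVec_add, mulVec_smul]

lemma sqnorm_add_smul (u v : Fin n → ℝ) (a : ℝ) :
    sqnorm (u + a • v) = sqnorm u + 2 * (u ⬝ᵥ v) * a + sqnorm v * a ^ 2 := by
  simp only [sqnorm, dotProduct, Finset.mul_sum, Finset.sum_mul, ← Finset.sum_add_distrib]
  exact Finset.sum_congr rfl fun i _ => by simp; ring

lemma sqnorm_dualSol_appendCol_le {A : Matrix (Fin n) (Fin d) ℝ} (hA : IsUnit (A * Aᵀ).det)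
    {b : Fin n → ℝ} (h : IsUnit (appendCol A b * (appendCol A b)ᵀ).det) (x : Fin d → ℝ) (a : ℝ) :
    sqnorm (dualSol (appendCol A b) (Fin.snoc x a)) ≤ sqnorm (dualSol A x)
      + a * (2 * (dualSol A x ⬝ᵥ ((A * Aᵀ)⁻¹ *ᵥ b)) / (1 + b ⬝ᵥ ((A * Aᵀ)⁻¹ *ᵥ b)))
      - 2 * ((b ⬝ᵥ dualSol A x) * (b ⬝ᵥ ((A * Aᵀ)⁻¹ *ᵥ dualSol A x)))
      + 2 * (a ^ 2 * (sqnorm b * frobSq (A * Aᵀ)⁻¹))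
      + 4 * (sqnorm b ^ 2 * (frobSq (A * Aᵀ)⁻¹ * sqnorm (dualSol A x))) := by
  have hK : b ⬝ᵥ ((A * Aᵀ)⁻¹ *ᵥ dualSol A x) = dualSol A x ⬝ᵥ ((A * Aᵀ)⁻¹ *ᵥ b) := by
    rw [dotProduct_comm, ← vecMul_transpose, gram_inv_isSymm, dotProduct_mulVec]
  rw [dualSol_appendCol hA h, sqnorm_add_smul, hK]
  have hs := sqnorm_nonneg (((A * Aᵀ)⁻¹ * A)ᵀ *ᵥ b)
  rw [← dotProduct_gram_inv_mulVec] at hs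
  have c1 := sq_dotProduct_le b ((A * Aᵀ)⁻¹ *ᵥ b)
  have c2 := sq_dotProduct_le (dualSol A x) ((A * Aᵀ)⁻¹ *ᵥ b)
  have c3 := sq_dotProduct_le b (dualSol A x)
  have c4 := sqnorm_mulVec_le (A * Aᵀ)⁻¹ b
  have c5 := sqnorm_nonneg b
  have c6 := sqnorm_nonneg (dualSol A x)
  have c7 := frobSq_nonneg (A * Aᵀ)⁻¹
  have c8 := sqnorm_nonneg ((A * Aᵀ)⁻¹ *ᵥ b)
  generalize b ⬝ᵥ ((A * Aᵀ)⁻¹ *ᵥ b) = s at *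
  generalize dualSol A x ⬝ᵥ ((A * Aᵀ)⁻¹ *ᵥ b) = t at *
  generalize b ⬝ᵥ dualSol A x = r at *
  generalize frobSq (A * Aᵀ)⁻¹ = F at *
  generalize sqnorm ((A * Aᵀ)⁻¹ *ᵥ b) = k at *
  generalize sqnorm (dualSol A x) = z at *
  generalize sqnorm b = B at *
  have e1 : s * (r * t) ≤ B ^ 2 * (F * z) := by
    refine le_of_abs_le (abs_le_of_sq_le_sq ?_ (by positivity))
    calc (s * (r * t)) ^ 2 = s ^ 2 * (r ^ 2 * t ^ 2) := by ring
      _ ≤ (B * (F * B)) * ((B * z) * (z * (F * B))) := by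
        gcongr
        · exact c1.trans (by gcongr)
        · exact c2.trans (by gcongr)
      _ = _ := by ring
  have e2 : s * (r * t) / (1 + s) ≤ B ^ 2 * (F * z) :=
    (div_le_of_le_mul₀ (by positivity) (by positivity)
      (e1.trans (le_mul_of_one_le_right (by positivity) (by linarith))))
  have e3 : k * ((a - r) / (1 + s)) ^ 2 ≤ 2 * (a ^ 2 * (B * F)) + 2 * (B ^ 2 * (F * z)) := by
    have : ((a - r) / (1 + s)) ^ 2 ≤ 2 * a ^ 2 + 2 * (B * z) := by
      rw [div_pow]
      refine (div_le_self (sq_nonneg _) (by nlinarith)).trans ?_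
      nlinarith [sq_nonneg (a + r)]
    calc k * ((a - r) / (1 + s)) ^ 2 ≤ (F * B) * (2 * a ^ 2 + 2 * (B * z)) := by gcongr
      _ = _ := by ring
  have e4 : 2 * t * ((a - r) / (1 + s))
      = a * (2 * t / (1 + s)) - 2 * (r * t) + 2 * (s * (r * t) / (1 + s)) := by
    field_simp
    ring
  linarith

lemma le_lambdaMax {K : Matrix (Fin n) (Fin n) ℝ} {t : ℝ} {v : Fin n → ℝ} (hv : v ≠ 0)
    (h : K *ᵥ v = t • v) : t ≤ lambdaMax K := by
  refine le_csSup ⟨frobSq K + 1, ?_⟩ ⟨v, hv, h⟩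
  rintro t ⟨v, hv, h⟩
  have h1 := sqnorm_mulVec_le K v
  have h2 : sqnorm (t • v) = t ^ 2 * sqnorm v := by simp [sqnorm, mul_pow, Finset.mul_sum]
  rw [h, h2] at h1
  have h3 : 0 < sqnorm v := (sqnorm_nonneg v).lt_of_ne' (sqnorm_eq_zero.not.2 hv)
  nlinarith [le_of_mul_le_mul_right h1 h3, frobSq_nonneg K]

lemma frobSq_gram_inv_le (A : Matrix (Fin n) (Fin d) ℝ) :
    frobSq (A * Aᵀ)⁻¹ ≤ n ^ 2 * lambdaMax ((A * Aᵀ)⁻¹) ^ 2 := by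
  have hpsd : ((A * Aᵀ)⁻¹).PosSemidef := by
    have := (posSemidef_self_mul_conjTranspose A).inv
    rwa [conjTranspose_eq_transpose_of_trivial] at this
  have h1 : ((A * Aᵀ)⁻¹).trace ≤ n * lambdaMax ((A * Aᵀ)⁻¹) := by
    rw [hpsd.1.trace_eq_sum_eigenvalues]
    calc _ ≤ ∑ _i : Fin n, lambdaMax ((A * Aᵀ)⁻¹) := Finset.sum_le_sum fun i _ => by
          refine le_lambdaMax (v := ⇑(hpsd.1.eigenvectorBasis i)) ?_
            (hpsd.1.mulVec_eigenvectorBasis i)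
          intro h0
          exact hpsd.1.eigenvectorBasis.toBasis.ne_zero i (by ext j; simpa using congrFun h0 j)
      _ = _ := by simp
  have h2 : frobSq (A * Aᵀ)⁻¹ ≤ ((A * Aᵀ)⁻¹).trace ^ 2 := by
    rw [pow_two, trace, Finset.sum_mul_sum, frobSq]
    refine Finset.sum_le_sum fun i _ => Finset.sum_le_sum fun j _ => ?_
    have e : ∀ i j, (A * Aᵀ)⁻¹ i j = ((A * Aᵀ)⁻¹ * A) i ⬝ᵥ ((A * Aᵀ)⁻¹ * A) j := fun i j => by
      conv_lhs => rw [gram_inv_eq]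
      rfl
    simp only [diag_apply]
    rw [e i j, e i i, e j j, ← sqnorm_eq_dotProduct, ← sqnorm_eq_dotProduct]
    exact sq_dotProduct_le _ _
  have h3 := hpsd.trace_nonneg
  calc _ ≤ _ := h2
    _ ≤ (n * lambdaMax ((A * Aᵀ)⁻¹)) ^ 2 := by gcongr
    _ = _ := by ring

end LinearAlgebra

section Measurability

variable {α : Type*} [MeasurableSpace α] {m n d k : ℕ}

lemma measurable_matrix_iff {f : α → Matrix (Fin m) (Fin n) ℝ} :
    Measurable f ↔ ∀ i j, Measurable fun a => f a i j :=
  measurable_pi_iff.trans (forall_congr' fun _ => measurable_pi_iff)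

lemma Measurable.matrix_entry {f : α → Matrix (Fin m) (Fin n) ℝ} (hf : Measurable f)
    (i : Fin m) (j : Fin n) : Measurable fun a => f a i j :=
  measurable_matrix_iff.1 hf i j

@[fun_prop]
lemma Measurable.matrix_transpose' {f : α → Matrix (Fin m) (Fin n) ℝ} (hf : Measurable f) :
    Measurable fun a => (f a)ᵀ :=
  measurable_matrix_iff.2 fun i j => hf.matrix_entry j i

@[fun_prop]
lemma Measurable.matrix_mul {f : α → Matrix (Fin m) (Fin n) ℝ} {g : α → Matrix (Fin n) (Fin k) ℝ}
    (hf : Measurable f) (hg : Measurable g) : Measurable fun a => f a * g a :=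
  measurable_matrix_iff.2 fun i j => by simp only [mul_apply]; fun_prop

@[fun_prop]
lemma Measurable.matrix_dotProduct {f g : α → Fin n → ℝ} (hf : Measurable f) (hg : Measurable g) :
    Measurable fun a => f a ⬝ᵥ g a := by
  simp only [dotProduct]; fun_prop

@[fun_prop]
lemma Measurable.matrix_mulVec {f : α → Matrix (Fin m) (Fin n) ℝ} {g : α → Fin n → ℝ}
    (hf : Measurable f) (hg : Measurable g) : Measurable fun a => f a *ᵥ g a :=
  measurable_pi_iff.2 fun i => by simp only [mulVec, dotProduct]; fun_prop

@[fun_prop]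
lemma Measurable.matrix_det' {f : α → Matrix (Fin n) (Fin n) ℝ} (hf : Measurable f) :
    Measurable fun a => (f a).det := by
  simp only [det_apply']; fun_prop

@[fun_prop]
lemma Measurable.matrix_inv {f : α → Matrix (Fin n) (Fin n) ℝ} (hf : Measurable f) :
    Measurable fun a => (f a)⁻¹ :=
  measurable_matrix_iff.2 fun i j => by
    simp only [inv_def, Ring.inverse_eq_inv', Matrix.smul_apply, smul_eq_mul, adjugate_apply]
    refine hf.matrix_det'.inv.mul (Measurable.matrix_det' (measurable_matrix_iff.2 fun k l => ?_))
    simp only [updateRow_apply]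
    split_ifs <;> fun_prop

@[fun_prop]
lemma Measurable.sqnorm {f : α → Fin n → ℝ} (hf : Measurable f) :
    Measurable fun a => sqnorm (f a) := by
  simp only [_root_.sqnorm]; fun_prop

@[fun_prop]
lemma Measurable.frobSq {f : α → Matrix (Fin m) (Fin n) ℝ} (hf : Measurable f) :
    Measurable fun a => frobSq (f a) := by
  simp only [_root_.frobSq]; fun_prop

@[fun_prop]
lemma Measurable.dualSol {f : α → Matrix (Fin n) (Fin d) ℝ} {g : α → Fin d → ℝ}
    (hf : Measurable f) (hg : Measurable g) : Measurable fun a => dualSol (f a) (g a) := by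
  simp only [_root_.dualSol]; fun_prop

@[fun_prop]
lemma Measurable.resid {f : α → Matrix (Fin n) (Fin d) ℝ} {g : α → Fin d → ℝ}
    (hf : Measurable f) (hg : Measurable g) : Measurable fun a => resid (f a) (g a) := by
  simp only [_root_.resid]; fun_prop

@[fun_prop]
lemma Measurable.fin_snoc {f : α → Fin d → ℝ} {g : α → ℝ} (hf : Measurable f) (hg : Measurable g) :
    Measurable fun a => (Fin.snoc (f a) (g a) : Fin (d + 1) → ℝ) :=
  measurable_pi_iff.2 fun i => by
    refine Fin.lastCases ?_ (fun i => ?_) i <;> simp <;> fun_prop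

@[fun_prop]
lemma Measurable.appendCol {f : α → Matrix (Fin n) (Fin d) ℝ} {g : α → Fin n → ℝ}
    (hf : Measurable f) (hg : Measurable g) : Measurable fun a => appendCol (f a) (g a) :=
  measurable_matrix_iff.2 fun i j => by
    refine Fin.lastCases ?_ (fun j => ?_) j <;> simp [_root_.appendCol] <;> fun_prop

end Measurability

section Gaussian

variable {n : ℕ}

/-- The law of `n` independent centred Gaussians of standard deviation `σ`. -/
abbrev gaussianVec (n : ℕ) (σ : ℝ) : Measure (Fin n → ℝ) :=
  Measure.pi fun _ : Fin n => gaussianReal 0 (σ ^ 2).toNNReal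

lemma integrable_pow_gaussianReal (m : ℝ) (v : ℝ≥0) (k : ℕ) :
    Integrable (fun y => y ^ k) (gaussianReal m v) :=
  by
  have h := (memLp_id_gaussianReal' (μ := m) (v := v) k (by simp)).integrable_norm_pow'
  exact h.mono (by fun_prop) (by simp)

lemma integral_sq_gaussianReal (σ : ℝ) :
    ∫ y, y ^ 2 ∂gaussianReal 0 (σ ^ 2).toNNReal = σ ^ 2 := by
  have h := variance_fun_id_gaussianReal (μ := 0) (v := (σ ^ 2).toNNReal)
  rw [variance_of_integral_eq_zero (by fun_prop) integral_id_gaussianReal] at h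
  rw [h, Real.coe_toNNReal _ (sq_nonneg _)]

lemma integral_pow_gaussianReal (σ : ℝ) (k : ℕ) :
    ∫ y, y ^ k ∂gaussianReal 0 (σ ^ 2).toNNReal = σ ^ k * ∫ y, y ^ k ∂gaussianReal 0 1 := by
  have h := gaussianReal_map_const_mul (μ := 0) (v := 1) σ
  rw [mul_zero, mul_one, ← Real.toNNReal_of_nonneg (sq_nonneg σ)] at h
  rw [← h, integral_map (by fun_prop) (by fun_prop), ← integral_const_mul]
  simp only [mul_pow]

lemma integrable_mul_gaussianVec (σ : ℝ) (i j : Fin n) :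
    Integrable (fun b => b i * b j) (gaussianVec n σ) := by
  have h : ∀ i : Fin n, MemLp (fun b : Fin n → ℝ => b i) 2 (gaussianVec n σ) := fun i =>
    (memLp_id_gaussianReal' 2 (by simp)).comp_measurePreserving (measurePreserving_eval _ i)
  exact (h i).integrable_mul (h j)

lemma integral_mul_gaussianVec (σ : ℝ) (i j : Fin n) :
    ∫ b, b i * b j ∂gaussianVec n σ = if i = j then σ ^ 2 else 0 := by
  split_ifs with h
  · subst h
    simp only [← pow_two]
    rw [← integral_sq_gaussianReal σ]
    exact integral_comp_eval (X := fun _ => ℝ)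
      (μ := fun _ : Fin n => gaussianReal 0 (σ ^ 2).toNNReal) (f := fun y : ℝ => y ^ 2)
      (by fun_prop)
  · have hind := (iIndepFun_pi (μ := fun _ : Fin n => gaussianReal 0 (σ ^ 2).toNNReal)
      (X := fun _ y => y) fun _ => by fun_prop).indepFun h
    rw [hind.integral_fun_mul_eq_mul_integral (measurable_pi_apply i).aestronglyMeasurable
        (measurable_pi_apply j).aestronglyMeasurable,
      integral_eval (i := i), integral_id_gaussianReal, zero_mul]

lemma integrable_pow_eval_gaussianVec (σ : ℝ) (i : Fin n) (k : ℕ) :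
    Integrable (fun b => b i ^ k) (gaussianVec n σ) :=
  integrable_comp_eval (X := fun _ => ℝ)
    (μ := fun _ : Fin n => gaussianReal 0 (σ ^ 2).toNNReal) (f := fun y : ℝ => y ^ k)
    (integrable_pow_gaussianReal _ _ k)

lemma integrable_eval_gaussianVec (σ : ℝ) (i : Fin n) :
    Integrable (fun b => b i) (gaussianVec n σ) :=
  by
  simpa using integrable_pow_eval_gaussianVec σ i 1

lemma dotProduct_mul_dotProduct (b u v : Fin n → ℝ) :
    (b ⬝ᵥ u) * (b ⬝ᵥ v) = ∑ i, ∑ j, (b i * b j) * (u i * v j) := by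
  rw [dotProduct, dotProduct, Finset.sum_mul_sum]
  exact Finset.sum_congr rfl fun i _ => Finset.sum_congr rfl fun j _ => by ring

lemma integral_dotProduct_mul_gaussianVec (σ : ℝ) (u v : Fin n → ℝ) :
    ∫ b, (b ⬝ᵥ u) * (b ⬝ᵥ v) ∂gaussianVec n σ = σ ^ 2 * (u ⬝ᵥ v) := by
  simp only [dotProduct_mul_dotProduct]
  rw [integral_finsetSum _ fun i _ => integrable_finsetSum _ fun j _ =>
    (integrable_mul_gaussianVec σ i j).mul_const _, dotProduct, Finset.mul_sum]
  refine Finset.sum_congr rfl fun i _ => ?_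
  rw [integral_finsetSum _ fun j _ => (integrable_mul_gaussianVec σ i j).mul_const _]
  simp only [integral_mul_const, integral_mul_gaussianVec, ite_mul, zero_mul, Finset.sum_ite_eq,
    Finset.mem_univ, if_true]

lemma integrable_sqnorm_gaussianVec (σ : ℝ) : Integrable sqnorm (gaussianVec n σ) :=
  integrable_finsetSum _ fun i _ => by
    simpa only [← pow_two] using integrable_mul_gaussianVec σ i i

lemma integral_sqnorm_gaussianVec (σ : ℝ) : ∫ b, sqnorm b ∂gaussianVec n σ = n * σ ^ 2 := by
  unfold sqnorm
  rw [integral_finsetSum _ fun i _ => by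
    simpa only [← pow_two] using integrable_mul_gaussianVec σ i i]
  simp only [pow_two (_ : ℝ), integral_mul_gaussianVec, if_true]
  simp

lemma sqnorm_sq_le (b : Fin n → ℝ) : sqnorm b ^ 2 ≤ n * ∑ i, b i ^ 4 := by
  have h := sq_sum_le_card_mul_sum_sq (s := Finset.univ) (f := fun i => b i ^ 2)
  simpa [sqnorm, ← pow_mul] using h

lemma integrable_sqnorm_sq_gaussianVec (σ : ℝ) :
    Integrable (fun b => sqnorm b ^ 2) (gaussianVec n σ) := by
  refine Integrable.mono' ((integrable_finsetSum Finset.univ fun i _ =>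
    integrable_pow_eval_gaussianVec σ i 4).const_mul (n : ℝ)) ?_ (ae_of_all _ fun b => ?_)
  · exact (measurable_id.sqnorm.pow_const 2).aestronglyMeasurable
  · rw [Real.norm_of_nonneg (by positivity)]
    exact sqnorm_sq_le b

lemma integral_sqnorm_sq_gaussianVec_le (σ : ℝ) :
    ∫ b, sqnorm b ^ 2 ∂gaussianVec n σ ≤ σ ^ 4 * (n ^ 2 * ∫ y, y ^ 4 ∂gaussianReal 0 1) := by
  refine (integral_mono (integrable_sqnorm_sq_gaussianVec σ)
    ((integrable_finsetSum Finset.univ fun i _ =>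
      integrable_pow_eval_gaussianVec σ i 4).const_mul (n : ℝ)) sqnorm_sq_le).trans_eq ?_
  rw [integral_const_mul, integral_finsetSum _ fun i _ => integrable_pow_eval_gaussianVec σ i 4]
  have h : ∀ i : Fin n, ∫ b, b i ^ 4 ∂gaussianVec n σ = σ ^ 4 * ∫ y, y ^ 4 ∂gaussianReal 0 1 :=
    fun i => by
      rw [← integral_pow_gaussianReal]
      exact integral_comp_eval (X := fun _ => ℝ)
        (μ := fun _ : Fin n => gaussianReal 0 (σ ^ 2).toNNReal) (f := fun y : ℝ => y ^ 4)
        (by fun_prop)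
  simp only [h, Finset.sum_const, Finset.card_univ, Fintype.card_fin, nsmul_eq_mul]
  ring

lemma not_integrable_inv_sq_gaussianReal (m : ℝ) {v : ℝ≥0} (hv : v ≠ 0) :
    ¬ Integrable (fun y => (y ^ 2)⁻¹) (gaussianReal m v) := by
  intro h
  rw [gaussianReal_of_var_ne_zero _ hv, integrable_withDensity_iff (by fun_prop)
    (ae_of_all _ fun _ => gaussianPDF_lt_top)] at h
  simp only [toReal_gaussianPDF] at h
  have hc : ContinuousOn (fun y => (gaussianPDFReal m v y)⁻¹) (Set.Icc 0 1) := by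
    refine Continuous.continuousOn (Continuous.inv₀ ?_ fun y => (gaussianPDFReal_pos m v y hv).ne')
    unfold gaussianPDFReal
    fun_prop
  have h2 := ((h.integrableOn (s := Set.Icc 0 1)).mul_continuousOn hc isCompact_Icc).mono_set
    Set.Ioo_subset_Icc_self
  have h3 := (intervalIntegral.integrableOn_Ioo_rpow_iff (s := -2) one_pos).1
    (h2.congr_fun (fun y hy => by
      simp only
      rw [mul_assoc, mul_inv_cancel₀ (gaussianPDFReal_pos m v y hv).ne', mul_one,
        Real.rpow_neg hy.1.le, Real.rpow_two]) measurableSet_Ioo)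
  norm_num at h3

lemma map_dotProduct_gaussianVec {σ : ℝ} (hσ : 0 < σ) {u : Fin n → ℝ} (hu : u ≠ 0) :
    ∃ m : ℝ, ∃ v : ℝ≥0, v ≠ 0 ∧
      (gaussianVec n σ).map (fun b => b ⬝ᵥ u) = gaussianReal m v := by
  have hX := (iIndepFun_pi (μ := fun _ : Fin n => gaussianReal 0 (σ ^ 2).toNNReal)
    (X := fun i y => y * u i) fun _ => by fun_prop).hasGaussianLaw (fun i => by
      refine ⟨?_⟩
      have h1 : (gaussianVec n σ).map (fun b => b i * u i)
          = ((gaussianVec n σ).map (fun b => b i)).map (fun y => y * u i) := by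
        rw [Measure.map_map (by fun_prop) (by fun_prop)]; rfl
      rw [h1, (measurePreserving_eval _ i).map_eq, gaussianReal_map_mul_const]
      infer_instance)
  refine ⟨_, _, ?_, hX.fun_sum.map_eq_gaussianReal⟩
  have h0 : ∫ b : Fin n → ℝ, ∑ i, b i * u i ∂gaussianVec n σ = 0 := by
    rw [integral_finsetSum _ fun i _ => (integrable_eval_gaussianVec σ i).mul_const _]
    simp [integral_mul_const, integral_eval]
  rw [variance_of_integral_eq_zero (Measurable.aemeasurable (by fun_prop)) h0]
  have h1 := integral_dotProduct_mul_gaussianVec σ u u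
  simp only [← pow_two, ← sqnorm_eq_dotProduct] at h1
  simp only [dotProduct] at h1
  rw [h1, Ne, Real.toNNReal_eq_zero, not_le]
  have := (sqnorm_nonneg u).lt_of_ne' (sqnorm_eq_zero.not.2 hu)
  positivity

lemma not_integrable_inv_dotProduct_sq_gaussianVec {σ : ℝ} (hσ : 0 < σ) {u : Fin n → ℝ}
    (hu : u ≠ 0) : ¬ Integrable (fun b => ((b ⬝ᵥ u) ^ 2)⁻¹) (gaussianVec n σ) := by
  obtain ⟨m, v, hv, h⟩ := map_dotProduct_gaussianVec hσ hu
  have := not_integrable_inv_sq_gaussianReal m hv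
  rwa [← h, integrable_map_measure (by fun_prop) (by fun_prop)] at this

end Gaussian

section ProductIntegrals

variable {Ω : Type*} [MeasurableSpace Ω] {κ : Measure Ω} {n : ℕ}

lemma integrable_dotProduct_mul_dotProduct_prod (σ : ℝ) {f g : Ω → Fin n → ℝ} (hf : Measurable f)
    (hg : Measurable g) (hf2 : Integrable (fun ω => sqnorm (f ω)) κ)
    (hg2 : Integrable (fun ω => sqnorm (g ω)) κ) :
    Integrable (fun q => (q.1 ⬝ᵥ f q.2) * (q.1 ⬝ᵥ g q.2)) ((gaussianVec n σ).prod κ) := by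
  refine ((integrable_sqnorm_gaussianVec σ).mul_prod (hf2.add hg2)).mono'
    (Measurable.aestronglyMeasurable (by fun_prop)) (ae_of_all _ fun q => ?_)
  have h1 := sq_dotProduct_le q.1 (f q.2)
  have h2 := sq_dotProduct_le q.1 (g q.2)
  simp only [Pi.add_apply, Real.norm_eq_abs]
  rw [abs_le]
  constructor <;> nlinarith [sq_nonneg (q.1 ⬝ᵥ f q.2 - q.1 ⬝ᵥ g q.2),
    sq_nonneg (q.1 ⬝ᵥ f q.2 + q.1 ⬝ᵥ g q.2)]

lemma integral_dotProduct_mul_dotProduct_prod [SFinite κ] (σ : ℝ) {f g : Ω → Fin n → ℝ} (hf : Measurable f)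
    (hg : Measurable g) (hf2 : Integrable (fun ω => sqnorm (f ω)) κ)
    (hg2 : Integrable (fun ω => sqnorm (g ω)) κ) :
    ∫ q, (q.1 ⬝ᵥ f q.2) * (q.1 ⬝ᵥ g q.2) ∂(gaussianVec n σ).prod κ
      = σ ^ 2 * ∫ ω, f ω ⬝ᵥ g ω ∂κ := by
  rw [integral_prod_symm _ (integrable_dotProduct_mul_dotProduct_prod σ hf hg hf2 hg2),
    ← integral_const_mul]
  simp only [integral_dotProduct_mul_gaussianVec]

/-- If `f` is not square integrable, both integrals take the default value `0`. -/
lemma integral_dotProduct_sq_prod [SFinite κ] {σ : ℝ} (hσ : 0 < σ) {f : Ω → Fin n → ℝ} (hf : Measurable f) :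
    ∫ q, (q.1 ⬝ᵥ f q.2) ^ 2 ∂(gaussianVec n σ).prod κ = σ ^ 2 * ∫ ω, sqnorm (f ω) ∂κ := by
  by_cases h : Integrable (fun ω => sqnorm (f ω)) κ
  · simp only [sqnorm_eq_dotProduct, pow_two (_ ⬝ᵥ _)]
    exact integral_dotProduct_mul_dotProduct_prod σ hf hf h h
  · rw [integral_undef h, mul_zero, integral_undef]
    intro hi
    have h2 := hi.integral_prod_right
    simp only [pow_two (_ ⬝ᵥ _), integral_dotProduct_mul_gaussianVec] at h2
    refine h ((h2.const_mul (σ ^ 2)⁻¹).congr (ae_of_all _ fun ω => ?_))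
    simp only [sqnorm_eq_dotProduct]
    field_simp

end ProductIntegrals

section Risk

variable {n d : ℕ}

lemma sqnorm_resid_le_sqnorm (A : Matrix (Fin n) (Fin d) ℝ) (x : Fin d → ℝ) :
    sqnorm (resid A x) ≤ sqnorm x := by
  by_cases h : IsUnit (A * Aᵀ).det
  · simpa using sqnorm_resid_le h x 0
  · simp [resid, dualSol, nonsing_inv_apply_not_isUnit _ h]

/-- The joint law of the new feature `(a₁, b)` and of the old data `(A, x)`. -/
abbrev dataLaw (σ : ℝ) (μA : Measure (Matrix (Fin n) (Fin d) ℝ)) (μx : Measure (Fin d → ℝ)) :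
    Measure (ℝ × (Fin n → ℝ) × Matrix (Fin n) (Fin d) ℝ × (Fin d → ℝ)) :=
  (gaussianReal 0 (σ ^ 2).toNNReal).prod ((gaussianVec n σ).prod (μA.prod μx))

variable (μA : Measure (Matrix (Fin n) (Fin d) ℝ)) [IsProbabilityMeasure μA]
  (μx : Measure (Fin d → ℝ)) [IsProbabilityMeasure μx]

lemma measurePreserving_rotate {α β γ : Type*} [MeasurableSpace α] [MeasurableSpace β]
    [MeasurableSpace γ] (a : Measure α) (b : Measure β) (c : Measure γ) [SFinite a] [SFinite b]
    [SFinite c] :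
    MeasurePreserving (fun p : α × β × γ => (p.2.2, p.2.1, p.1)) (a.prod (b.prod c))
      (c.prod (b.prod a)) := by
  have h1 : MeasurePreserving (fun p : α × β × γ => (p.2, p.1)) (a.prod (b.prod c))
      ((b.prod c).prod a) := Measure.measurePreserving_swap
  have h2 : MeasurePreserving (fun p : (β × γ) × α => (p.1.swap, p.2)) ((b.prod c).prod a)
      ((c.prod b).prod a) := Measure.measurePreserving_swap.prod (.id a)
  exact (measurePreserving_prodAssoc c b a).comp (h2.comp h1)

lemma measurePreserving_left_comm {α β γ : Type*} [MeasurableSpace α] [MeasurableSpace β]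
    [MeasurableSpace γ] (a : Measure α) (b : Measure β) (c : Measure γ) [SFinite a] [SFinite b]
    [SFinite c] :
    MeasurePreserving (fun p : α × β × γ => (p.2.1, p.1, p.2.2)) (a.prod (b.prod c))
      (b.prod (a.prod c)) := by
  have h : MeasurePreserving (fun p : (α × β) × γ => (p.1.swap, p.2)) ((a.prod b).prod c)
      ((b.prod a).prod c) := Measure.measurePreserving_swap.prod (.id c)
  exact (measurePreserving_prodAssoc b a c).comp (h.comp (measurePreserving_prodAssoc a b c).symm)

lemma measurePreserving_snoc (ρ : ℝ) :
    MeasurePreserving (fun p : ℝ × (Fin d → ℝ) => (Fin.snoc p.2 p.1 : Fin (d + 1) → ℝ))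
      ((gaussianReal 0 (ρ ^ 2).toNNReal).prod (gaussianVec d ρ)) (gaussianVec (d + 1) ρ) := by
  have h := (measurePreserving_piFinSuccAbove
    (fun _ : Fin (d + 1) => gaussianReal 0 (ρ ^ 2).toNNReal) (Fin.last d)).symm
  convert h using 1
  ext p i
  simp [MeasurableEquiv.piFinSuccAbove]

lemma measurePreserving_jointLaw (ρ σ : ℝ) :
    MeasurePreserving (fun p : ℝ × ℝ × (Fin d → ℝ) × (Fin d → ℝ) × Matrix (Fin n) (Fin d) ℝ ×
        (Fin n → ℝ) => ((Fin.snoc p.2.2.2.1 p.2.1 : Fin (d + 1) → ℝ),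
          (p.1, (p.2.2.2.2.2, (p.2.2.2.2.1, p.2.2.1)))))
      (jointLaw n d ρ (gaussianReal 0 (σ ^ 2).toNNReal) μA μx)
      ((gaussianVec (d + 1) ρ).prod (dataLaw σ μA μx)) := by
  set θ := gaussianReal 0 (σ ^ 2).toNNReal
  set g := gaussianReal 0 (ρ ^ 2).toNNReal
  have h1 : MeasurePreserving (fun p : (Fin d → ℝ) × (Fin d → ℝ) × Matrix (Fin n) (Fin d) ℝ ×
      (Fin n → ℝ) => (p.2.1, (p.2.2.2, (p.2.2.1, p.1)))) (μx.prod ((gaussianVec d ρ).prod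
        (μA.prod (gaussianVec n σ))))
      ((gaussianVec d ρ).prod ((gaussianVec n σ).prod (μA.prod μx))) :=
    ((MeasurePreserving.id _).prod (measurePreserving_rotate _ _ _)).comp
      (measurePreserving_left_comm _ _ _)
  have h2 : MeasurePreserving (fun p : ℝ × (Fin d → ℝ) × (Fin d → ℝ) × Matrix (Fin n) (Fin d) ℝ ×
      (Fin n → ℝ) => ((Fin.snoc p.2.2.1 p.1 : Fin (d + 1) → ℝ), (p.2.2.2.2, (p.2.2.2.1, p.2.1))))
      (g.prod (μx.prod ((gaussianVec d ρ).prod (μA.prod (gaussianVec n σ)))))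
      ((gaussianVec (d + 1) ρ).prod ((gaussianVec n σ).prod (μA.prod μx))) :=
    ((measurePreserving_snoc ρ).prod (.id _)).comp
      ((measurePreserving_prodAssoc _ _ _).symm.comp ((MeasurePreserving.id g).prod h1))
  exact (measurePreserving_left_comm _ _ _).comp ((MeasurePreserving.id θ).prod h2)

lemma measurePreserving_dataLaw (σ : ℝ) :
    MeasurePreserving (fun p : ℝ × (Fin n → ℝ) × Matrix (Fin n) (Fin d) ℝ × (Fin d → ℝ) => p.2.2)
      (dataLaw σ μA μx) (μA.prod μx) :=
  measurePreserving_snd.comp measurePreserving_snd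

lemma ae_dataLaw_isUnit {σ : ℝ}
    (hli : ∀ᵐ q : Matrix (Fin n) (Fin d) ℝ × (Fin n → ℝ) ∂μA.prod (gaussianVec n σ),
      LinearIndependent ℝ (fun i => appendCol q.1 q.2 i)) :
    ∀ᵐ p ∂dataLaw σ μA μx,
      IsUnit (appendCol p.2.2.1 p.2.1 * (appendCol p.2.2.1 p.2.1)ᵀ).det := by
  have h : MeasurePreserving (fun p : ℝ × (Fin n → ℝ) × Matrix (Fin n) (Fin d) ℝ × (Fin d → ℝ) =>
      (p.2.2.1, p.2.1)) (dataLaw σ μA μx) (μA.prod (gaussianVec n σ)) :=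
    (Measure.measurePreserving_swap.comp ((MeasurePreserving.id _).prod measurePreserving_fst)).comp
      measurePreserving_snd
  filter_upwards [h.quasiMeasurePreserving.ae hli] with p hp
  exact gram_isUnit_of_linearIndependent hp

lemma LexpD_jointLaw (η σ : ℝ) {ρ : ℝ} (hρ : 0 < ρ) :
    LexpD n d η (jointLaw n d ρ (gaussianReal 0 (σ ^ 2).toNNReal) μA μx)
      = ρ ^ 2 * ∫ q, sqnorm (resid q.1 q.2) ∂μA.prod μx
        + η ^ 2 * ∫ q, sqnorm (dualSol q.1 q.2) ∂μA.prod μx := by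
  have hS := measurePreserving_jointLaw μA μx ρ σ
  have hT := measurePreserving_dataLaw μA μx σ
  rw [LexpD]
  congr 2
  · have h := integral_dotProduct_sq_prod (κ := dataLaw σ μA μx) hρ (f := fun p =>
      (Fin.snoc (resid p.2.2.1 p.2.2.2) 0 : Fin (d + 1) → ℝ)) (by fun_prop)
    simp only [sqnorm_snoc] at h
    rw [← hS.map_eq, integral_map hS.aemeasurable (Measurable.aestronglyMeasurable (by fun_prop))]
      at h
    rw [← hT.map_eq, integral_map hT.aemeasurable (Measurable.aestronglyMeasurable (by fun_prop))]
    simp only [dotProduct_pinvRows_mul_sub_one, neg_sq]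
    simpa [dotProduct, Fin.sum_univ_castSucc, mul_comm] using h
  · have h := (hT.comp (measurePreserving_snd.comp hS)).map_eq
    rw [← h, integral_map (hT.comp (measurePreserving_snd.comp hS)).aemeasurable
      (Measurable.aestronglyMeasurable (by fun_prop))]
    simp only [pinvCols_transpose_mulVec, Function.comp_apply]

lemma LexpD1_jointLaw (η σ : ℝ) {ρ : ℝ} (hρ : 0 < ρ) :
    LexpD1 n d η (jointLaw n d ρ (gaussianReal 0 (σ ^ 2).toNNReal) μA μx)
      = ρ ^ 2 * ∫ p, sqnorm (resid (appendCol p.2.2.1 p.2.1) (Fin.snoc p.2.2.2 p.1))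
          ∂dataLaw σ μA μx
        + η ^ 2 * ∫ p, sqnorm (dualSol (appendCol p.2.2.1 p.2.1) (Fin.snoc p.2.2.2 p.1))
          ∂dataLaw σ μA μx := by
  have hS := measurePreserving_jointLaw μA μx ρ σ
  rw [LexpD1]
  congr 2
  · have h := integral_dotProduct_sq_prod (κ := dataLaw σ μA μx) hρ (f := fun p =>
      resid (appendCol p.2.2.1 p.2.1) (Fin.snoc p.2.2.2 p.1)) (by fun_prop)
    rw [← hS.map_eq, integral_map hS.aemeasurable (Measurable.aestronglyMeasurable (by fun_prop))]
      at h
    simpa only [dotProduct_pinvRows_mul_sub_one, neg_sq, dotProduct_comm] using h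
  · have h := (measurePreserving_snd.comp hS).map_eq
    rw [← h, integral_map (measurePreserving_snd.comp hS).aemeasurable
      (Measurable.aestronglyMeasurable (by fun_prop))]
    simp only [appendRow_transpose, pinvCols_transpose_mulVec, Function.comp_apply]

variable {μA μx}

lemma integral_sub_dotProduct_sq {Ω : Type*} [MeasurableSpace Ω] {κ : Measure Ω}
    [IsProbabilityMeasure κ] (σ : ℝ) {f : Ω → Fin n → ℝ} (hf : Measurable f)
    (hf2 : Integrable (fun ω => sqnorm (f ω)) κ) :
    Integrable (fun p => (p.1 - p.2.1 ⬝ᵥ f p.2.2) ^ 2)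
        ((gaussianReal 0 (σ ^ 2).toNNReal).prod ((gaussianVec n σ).prod κ)) ∧
      ∫ p, (p.1 - p.2.1 ⬝ᵥ f p.2.2) ^ 2
        ∂(gaussianReal 0 (σ ^ 2).toNNReal).prod ((gaussianVec n σ).prod κ)
        = σ ^ 2 * (1 + ∫ ω, sqnorm (f ω) ∂κ) := by
  set θ := gaussianReal 0 (σ ^ 2).toNNReal
  have i1 : Integrable (fun p : ℝ × (Fin n → ℝ) × Ω => p.1 ^ 2)
      (θ.prod ((gaussianVec n σ).prod κ)) :=
    (integrable_pow_gaussianReal 0 (σ ^ 2).toNNReal 2).comp_fst _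
  have i2 : Integrable (fun q => (q.1 ⬝ᵥ f q.2) ^ 2) ((gaussianVec n σ).prod κ) := by
    simpa only [pow_two] using integrable_dotProduct_mul_dotProduct_prod σ hf hf hf2 hf2
  have i3 : Integrable (fun q => q.1 ⬝ᵥ f q.2) ((gaussianVec n σ).prod κ) :=
    ((memLp_two_iff_integrable_sq (Measurable.aestronglyMeasurable (by fun_prop))).2 i2).integrable
      one_le_two
  have i4 : Integrable (fun p : ℝ × (Fin n → ℝ) × Ω => p.1 * (p.2.1 ⬝ᵥ f p.2.2))
      (θ.prod ((gaussianVec n σ).prod κ)) :=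
    Integrable.mul_prod (by simpa using integrable_pow_gaussianReal 0 (σ ^ 2).toNNReal 1) i3
  have i5 : Integrable (fun p : ℝ × (Fin n → ℝ) × Ω => (p.2.1 ⬝ᵥ f p.2.2) ^ 2)
      (θ.prod ((gaussianVec n σ).prod κ)) := i2.comp_snd θ
  have h : ∀ p : ℝ × (Fin n → ℝ) × Ω, (p.1 - p.2.1 ⬝ᵥ f p.2.2) ^ 2
      = p.1 ^ 2 - 2 * (p.1 * (p.2.1 ⬝ᵥ f p.2.2)) + (p.2.1 ⬝ᵥ f p.2.2) ^ 2 := fun p => by ring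
  have i6 : Integrable (fun p : ℝ × (Fin n → ℝ) × Ω => p.1 ^ 2 - 2 * (p.1 * (p.2.1 ⬝ᵥ f p.2.2)))
      (θ.prod ((gaussianVec n σ).prod κ)) := i1.sub (i4.const_mul 2)
  simp only [h]
  refine ⟨i6.add i5, ?_⟩
  rw [integral_add i6 i5, integral_sub i1 (i4.const_mul 2),
    integral_const_mul, integral_prod_mul (μ := θ) (fun a : ℝ => a) fun q : (Fin n → ℝ) × Ω => q.1 ⬝ᵥ f q.2,
    integral_id_gaussianReal,
    integral_fun_fst (μ := θ) (f := fun a : ℝ => a ^ 2), integral_sq_gaussianReal,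
    integral_fun_snd (μ := θ) (f := fun q : (Fin n → ℝ) × Ω => (q.1 ⬝ᵥ f q.2) ^ 2)]
  simp only [pow_two (_ ⬝ᵥ _), integral_dotProduct_mul_dotProduct_prod σ hf hf hf2 hf2,
    ← sqnorm_eq_dotProduct]
  simp
  ring

/-- If the residual of the extended data is square integrable, so is that of the old data. -/
lemma integrable_sqnorm_resid_of_appendCol {σ : ℝ}
    (hC : 0 < ∫ q, dualSol q.1 q.2 ⬝ᵥ ((q.1 * q.1ᵀ)⁻¹ *ᵥ dualSol q.1 q.2) ∂μA.prod μx)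
    (hz : Integrable (fun q => sqnorm (dualSol q.1 q.2)) (μA.prod μx))
    (h : Integrable (fun p => sqnorm (resid (appendCol p.2.2.1 p.2.1) (Fin.snoc p.2.2.2 p.1)))
      (dataLaw σ μA μx)) :
    Integrable (fun q => sqnorm (resid q.1 q.2)) (μA.prod μx) := by
  have hT := measurePreserving_dataLaw μA μx σ
  set S : Set (Matrix (Fin n) (Fin d) ℝ × (Fin d → ℝ)) := {q | IsUnit (q.1 * q.1ᵀ).det} with hS
  have hSm : MeasurableSet S := by
    simp only [hS, isUnit_iff_ne_zero]
    exact (measurableSet_eq_fun (by fun_prop) (by fun_prop)).compl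
  have hm : Measurable (S.indicator fun q => sqnorm (resid q.1 q.2)) :=
    Measurable.indicator (by fun_prop) hSm
  have h1 : Integrable (S.indicator fun q => sqnorm (resid q.1 q.2)) (μA.prod μx) := by
    rw [← hT.integrable_comp hm.aestronglyMeasurable]
    refine h.mono' (hm.comp hT.measurable).aestronglyMeasurable (ae_of_all _ fun p => ?_)
    rw [Function.comp_apply]
    by_cases hp : p.2.2 ∈ S
    · rw [Set.indicator_of_mem hp, Real.norm_of_nonneg (sqnorm_nonneg _)]
      exact le_sqnorm_resid_appendCol hp _ _ _
    · rw [Set.indicator_of_notMem hp, norm_zero]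
      exact sqnorm_nonneg _
  obtain ⟨A, hA, hA1, hA2⟩ : ∃ A, IsUnit (A * Aᵀ).det ∧
      Integrable (fun x => sqnorm (resid A x)) μx ∧
      Integrable (fun x => sqnorm (dualSol A x)) μx := by
    by_contra! hcon
    have h0 : ∀ᵐ A ∂μA, ¬ IsUnit (A * Aᵀ).det := by
      filter_upwards [h1.prod_right_ae, hz.prod_right_ae] with A hA1 hA2 hA
      refine hcon A hA ?_ hA2
      simpa [hS, Set.indicator, isUnit_iff_ne_zero.1 hA] using hA1
    refine hC.ne' (integral_eq_zero_of_ae ?_)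
    filter_upwards [(measurePreserving_fst (ν := μx)).quasiMeasurePreserving.ae h0] with q hq
    simp [nonsing_inv_apply_not_isUnit _ hq]
  have hx : Integrable sqnorm μx :=
    ((hA1.const_mul 2).add (hA2.const_mul (2 * frobSq Aᵀ))).mono'
      (measurable_id.sqnorm).aestronglyMeasurable (ae_of_all _ fun x => by
        rw [Real.norm_of_nonneg (sqnorm_nonneg _)]
        exact sqnorm_le_resid A x)
  refine (hx.comp_snd μA).mono' (Measurable.aestronglyMeasurable (by fun_prop))
    (ae_of_all _ fun q => ?_)
  rw [Real.norm_of_nonneg (sqnorm_nonneg _)]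
  exact sqnorm_resid_le_sqnorm _ _

lemma integral_sqnorm_resid_appendCol_le {σ : ℝ}
    (hli : ∀ᵐ q : Matrix (Fin n) (Fin d) ℝ × (Fin n → ℝ) ∂μA.prod (gaussianVec n σ),
      LinearIndependent ℝ (fun i => appendCol q.1 q.2 i))
    (hC : 0 < ∫ q, dualSol q.1 q.2 ⬝ᵥ ((q.1 * q.1ᵀ)⁻¹ *ᵥ dualSol q.1 q.2) ∂μA.prod μx)
    (hz : Integrable (fun q => sqnorm (dualSol q.1 q.2)) (μA.prod μx)) :
    ∫ p, sqnorm (resid (appendCol p.2.2.1 p.2.1) (Fin.snoc p.2.2.2 p.1)) ∂dataLaw σ μA μx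
      ≤ ∫ q, sqnorm (resid q.1 q.2) ∂μA.prod μx
        + σ ^ 2 * (1 + ∫ q, sqnorm (dualSol q.1 q.2) ∂μA.prod μx) := by
  have hT := measurePreserving_dataLaw μA μx σ
  by_cases hr : Integrable (fun q => sqnorm (resid q.1 q.2)) (μA.prod μx)
  · obtain ⟨h1, h2⟩ := integral_sub_dotProduct_sq σ
      (f := fun q : Matrix (Fin n) (Fin d) ℝ × (Fin d → ℝ) => dualSol q.1 q.2) (by fun_prop) hz
    have hr2 : Integrable (fun p => sqnorm (resid p.2.2.1 p.2.2.2)) (dataLaw σ μA μx) :=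
      hT.integrable_comp_of_integrable hr
    rw [← h2, ← hT.map_eq, integral_map hT.aemeasurable
      (Measurable.aestronglyMeasurable (by fun_prop)), hT.map_eq, ← integral_add hr2 h1]
    refine integral_mono_of_nonneg (ae_of_all _ fun _ => sqnorm_nonneg _) (hr2.add h1) ?_
    filter_upwards [ae_dataLaw_isUnit μA μx hli] with p hp
    exact sqnorm_resid_appendCol_le hp _ _
  · rw [integral_undef hr, integral_undef (mt (integrable_sqnorm_resid_of_appendCol hC hz) hr)]
    have : 0 ≤ ∫ q, sqnorm (dualSol q.1 q.2) ∂μA.prod μx := integral_nonneg fun _ => sqnorm_nonneg _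
    positivity

/-- A square integrable extended solution forces `A` to have linearly independent rows. -/
lemma ae_isUnit_of_integrable_sqnorm_dualSol_appendCol {σ : ℝ} (hσ : 0 < σ)
    (hli : ∀ᵐ q : Matrix (Fin n) (Fin d) ℝ × (Fin n → ℝ) ∂μA.prod (gaussianVec n σ),
      LinearIndependent ℝ (fun i => appendCol q.1 q.2 i))
    (h : Integrable (fun p => sqnorm (dualSol (appendCol p.2.2.1 p.2.1) (Fin.snoc p.2.2.2 p.1)))
      (dataLaw σ μA μx)) :
    ∀ᵐ A ∂μA, IsUnit (A * Aᵀ).det := by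
  have i1 : ∀ u v : Fin n → ℝ, ∫ a, sqnorm (u + a • v) ∂gaussianReal 0 (σ ^ 2).toNNReal
      = sqnorm u + σ ^ 2 * sqnorm v := by
    intro u v
    have j1 : Integrable (fun a : ℝ => 2 * (u ⬝ᵥ v) * a)
        (gaussianReal 0 (σ ^ 2).toNNReal) :=
      Integrable.const_mul (by simpa using integrable_pow_gaussianReal 0 (σ ^ 2).toNNReal 1) _
    have j2 : Integrable (fun a : ℝ => sqnorm v * a ^ 2)
        (gaussianReal 0 (σ ^ 2).toNNReal) :=
      (integrable_pow_gaussianReal 0 (σ ^ 2).toNNReal 2).const_mul _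
    have j3 : Integrable (fun a : ℝ => sqnorm u + 2 * (u ⬝ᵥ v) * a)
        (gaussianReal 0 (σ ^ 2).toNNReal) := (integrable_const _).add j1
    simp only [sqnorm_add_smul]
    rw [integral_add j3 j2, integral_add (integrable_const _) j1, integral_const_mul,
      integral_const_mul, integral_sq_gaussianReal, integral_id_gaussianReal]
    simp [mul_comm]
  have h1 := h.integral_prod_right
  simp only [dualSol_appendCol_eq_add, i1] at h1
  have hT : MeasurePreserving (fun q : (Fin n → ℝ) × Matrix (Fin n) (Fin d) ℝ × (Fin d → ℝ) =>
      (q.1, q.2.1)) ((gaussianVec n σ).prod (μA.prod μx)) ((gaussianVec n σ).prod μA) :=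
    (MeasurePreserving.id _).prod measurePreserving_fst
  have hm : Measurable fun q : (Fin n → ℝ) × Matrix (Fin n) (Fin d) ℝ =>
    sqnorm ((appendCol q.2 q.1 * (appendCol q.2 q.1)ᵀ)⁻¹ *ᵥ q.1) := by fun_prop
  have h2 : Integrable (fun q : (Fin n → ℝ) × Matrix (Fin n) (Fin d) ℝ =>
      sqnorm ((appendCol q.2 q.1 * (appendCol q.2 q.1)ᵀ)⁻¹ *ᵥ q.1))
      ((gaussianVec n σ).prod μA) := by
    rw [← hT.integrable_comp hm.aestronglyMeasurable]
    refine (h1.const_mul (σ ^ 2)⁻¹).mono' (hm.comp hT.measurable).aestronglyMeasurable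
      (ae_of_all _ fun q => ?_)
    rw [Function.comp_apply, Real.norm_of_nonneg (sqnorm_nonneg _), le_inv_mul_iff₀ (by positivity)]
    exact le_add_of_nonneg_left (sqnorm_nonneg _)
  filter_upwards [h2.prod_left_ae, Measure.ae_ae_of_ae_prod hli] with A hA1 hA2
  by_contra hA
  obtain ⟨u, hu0, hu⟩ := Matrix.exists_mulVec_eq_zero_iff.2 (not_not.1 (isUnit_iff_ne_zero.not.1 hA))
  refine not_integrable_inv_dotProduct_sq_gaussianVec hσ hu0
    ((hA1.const_mul (sqnorm u)⁻¹).congr ?_)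
  filter_upwards [hA2] with b hb
  rw [dualSol_appendCol_of_ker hu0 hu (gram_isUnit_of_linearIndependent hb), div_eq_mul_inv,
    inv_mul_cancel_left₀ (sqnorm_eq_zero.not.2 hu0)]

lemma integral_sqnorm_dualSol_appendCol_le {σ : ℝ}
    (hli : ∀ᵐ q : Matrix (Fin n) (Fin d) ℝ × (Fin n → ℝ) ∂μA.prod (gaussianVec n σ),
      LinearIndependent ℝ (fun i => appendCol q.1 q.2 i))
    (hA : ∀ᵐ A ∂μA, IsUnit (A * Aᵀ).det)
    (hz : Integrable (fun q => sqnorm (dualSol q.1 q.2)) (μA.prod μx))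
    (hF : Integrable (fun q => frobSq (q.1 * q.1ᵀ)⁻¹) (μA.prod μx))
    (hFz : Integrable (fun q => frobSq (q.1 * q.1ᵀ)⁻¹ * sqnorm (dualSol q.1 q.2)) (μA.prod μx)) :
    ∫ p, sqnorm (dualSol (appendCol p.2.2.1 p.2.1) (Fin.snoc p.2.2.2 p.1)) ∂dataLaw σ μA μx
      ≤ ∫ q, sqnorm (dualSol q.1 q.2) ∂μA.prod μx
        - 2 * (σ ^ 2 * ∫ q, dualSol q.1 q.2 ⬝ᵥ ((q.1 * q.1ᵀ)⁻¹ *ᵥ dualSol q.1 q.2) ∂μA.prod μx)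
        + σ ^ 4 * (2 * (n * ∫ q, frobSq (q.1 * q.1ᵀ)⁻¹ ∂μA.prod μx)
          + 4 * (n ^ 2 * (∫ y, y ^ 4 ∂gaussianReal 0 1)
            * ∫ q, frobSq (q.1 * q.1ᵀ)⁻¹ * sqnorm (dualSol q.1 q.2) ∂μA.prod μx)) := by
  set θ := gaussianReal 0 (σ ^ 2).toNNReal
  set κ := μA.prod μx
  set f := fun q : (Fin n → ℝ) × Matrix (Fin n) (Fin d) ℝ × (Fin d → ℝ) =>
    2 * (dualSol q.2.1 q.2.2 ⬝ᵥ ((q.2.1 * q.2.1ᵀ)⁻¹ *ᵥ q.1)) /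
      (1 + q.1 ⬝ᵥ ((q.2.1 * q.2.1ᵀ)⁻¹ *ᵥ q.1)) with hf
  have i1 : Integrable (fun p : ℝ × (Fin n → ℝ) × Matrix (Fin n) (Fin d) ℝ × (Fin d → ℝ) =>
      sqnorm (dualSol p.2.2.1 p.2.2.2)) (dataLaw σ μA μx) :=
    (measurePreserving_dataLaw μA μx σ).integrable_comp_of_integrable hz
  have i0 : Integrable f ((gaussianVec n σ).prod κ) := by
    have hb := (integrable_sqnorm_gaussianVec (n := n) σ).mul_prod hF
    refine (hb.add (hz.comp_snd (gaussianVec n σ))).mono'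
      (Measurable.aestronglyMeasurable (by fun_prop)) (ae_of_all _ fun q => ?_)
    have hs : 1 ≤ 1 + q.1 ⬝ᵥ ((q.2.1 * q.2.1ᵀ)⁻¹ *ᵥ q.1) := by
      rw [dotProduct_gram_inv_mulVec]
      exact le_add_of_nonneg_right (sqnorm_nonneg _)
    have h1 := sq_dotProduct_le (dualSol q.2.1 q.2.2) ((q.2.1 * q.2.1ᵀ)⁻¹ *ᵥ q.1)
    have h2 := sqnorm_mulVec_le (q.2.1 * q.2.1ᵀ)⁻¹ q.1
    have h3 := sqnorm_nonneg (dualSol q.2.1 q.2.2)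
    have h4 := sqnorm_nonneg ((q.2.1 * q.2.1ᵀ)⁻¹ *ᵥ q.1)
    have h5 : |2 * (dualSol q.2.1 q.2.2 ⬝ᵥ ((q.2.1 * q.2.1ᵀ)⁻¹ *ᵥ q.1))|
        ≤ sqnorm q.1 * frobSq (q.2.1 * q.2.1ᵀ)⁻¹ + sqnorm (dualSol q.2.1 q.2.2) := by
      refine abs_le_of_sq_le_sq (by nlinarith [sq_nonneg (sqnorm (dualSol q.2.1 q.2.2)
        - sqnorm ((q.2.1 * q.2.1ᵀ)⁻¹ *ᵥ q.1))]) (by linarith)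
    rw [hf, Real.norm_eq_abs, abs_div, abs_of_pos (zero_lt_one.trans_le hs)]
    exact (div_le_self (abs_nonneg _) hs).trans h5
  have i2 : Integrable (fun p => p.1 * f p.2) (dataLaw σ μA μx) :=
    Integrable.mul_prod (by simpa using integrable_pow_gaussianReal 0 (σ ^ 2).toNNReal 1) i0
  have hKz : Integrable (fun q : Matrix (Fin n) (Fin d) ℝ × (Fin d → ℝ) =>
      sqnorm ((q.1 * q.1ᵀ)⁻¹ *ᵥ dualSol q.1 q.2)) κ :=
    hFz.mono' (Measurable.aestronglyMeasurable (by fun_prop)) (ae_of_all _ fun q => by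
      rw [Real.norm_of_nonneg (sqnorm_nonneg _)]
      exact sqnorm_mulVec_le _ _)
  have i3 : Integrable (fun p : ℝ × (Fin n → ℝ) × Matrix (Fin n) (Fin d) ℝ × (Fin d → ℝ) =>
      (p.2.1 ⬝ᵥ dualSol p.2.2.1 p.2.2.2) * (p.2.1 ⬝ᵥ ((p.2.2.1 * p.2.2.1ᵀ)⁻¹ *ᵥ
        dualSol p.2.2.1 p.2.2.2))) (dataLaw σ μA μx) :=
    (integrable_dotProduct_mul_dotProduct_prod σ
      (f := fun q : Matrix (Fin n) (Fin d) ℝ × (Fin d → ℝ) => dualSol q.1 q.2)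
      (g := fun q => (q.1 * q.1ᵀ)⁻¹ *ᵥ dualSol q.1 q.2)
      (by fun_prop) (by fun_prop) hz hKz).comp_snd θ
  have i4 : Integrable (fun p : ℝ × (Fin n → ℝ) × Matrix (Fin n) (Fin d) ℝ × (Fin d → ℝ) =>
      p.1 ^ 2 * (sqnorm p.2.1 * frobSq (p.2.2.1 * p.2.2.1ᵀ)⁻¹)) (dataLaw σ μA μx) :=
    (integrable_pow_gaussianReal 0 (σ ^ 2).toNNReal 2).mul_prod
      ((integrable_sqnorm_gaussianVec σ).mul_prod hF)
  have i5 : Integrable (fun p : ℝ × (Fin n → ℝ) × Matrix (Fin n) (Fin d) ℝ × (Fin d → ℝ) =>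
      sqnorm p.2.1 ^ 2 * (frobSq (p.2.2.1 * p.2.2.1ᵀ)⁻¹ * sqnorm (dualSol p.2.2.1 p.2.2.2)))
      (dataLaw σ μA μx) :=
    ((integrable_sqnorm_sq_gaussianVec σ).mul_prod hFz).comp_snd θ
  have e1 : ∫ p : ℝ × (Fin n → ℝ) × Matrix (Fin n) (Fin d) ℝ × (Fin d → ℝ),
      sqnorm (dualSol p.2.2.1 p.2.2.2) ∂dataLaw σ μA μx
      = ∫ q, sqnorm (dualSol q.1 q.2) ∂κ := by
    have hT := measurePreserving_dataLaw μA μx σ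
    rw [show κ = _ from hT.map_eq.symm, integral_map hT.aemeasurable
      (Measurable.aestronglyMeasurable (by fun_prop))]
  have e2 : ∫ p, p.1 * f p.2 ∂dataLaw σ μA μx = 0 := by
    rw [integral_prod_mul (μ := θ) (fun a : ℝ => a) f, integral_id_gaussianReal, zero_mul]
  have e3 : ∫ p : ℝ × (Fin n → ℝ) × Matrix (Fin n) (Fin d) ℝ × (Fin d → ℝ),
      (p.2.1 ⬝ᵥ dualSol p.2.2.1 p.2.2.2) * (p.2.1 ⬝ᵥ ((p.2.2.1 * p.2.2.1ᵀ)⁻¹ *ᵥ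
        dualSol p.2.2.1 p.2.2.2)) ∂dataLaw σ μA μx
      = σ ^ 2 * ∫ q, dualSol q.1 q.2 ⬝ᵥ ((q.1 * q.1ᵀ)⁻¹ *ᵥ dualSol q.1 q.2) ∂κ := by
    rw [← integral_dotProduct_mul_dotProduct_prod σ
      (f := fun q : Matrix (Fin n) (Fin d) ℝ × (Fin d → ℝ) => dualSol q.1 q.2)
      (g := fun q => (q.1 * q.1ᵀ)⁻¹ *ᵥ dualSol q.1 q.2) (by fun_prop) (by fun_prop) hz hKz]
    have := integral_fun_snd (μ := θ) (ν := (gaussianVec n σ).prod κ)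
      (f := fun q => (q.1 ⬝ᵥ dualSol q.2.1 q.2.2) * (q.1 ⬝ᵥ ((q.2.1 * q.2.1ᵀ)⁻¹ *ᵥ
        dualSol q.2.1 q.2.2)))
    simpa using this
  have e4 : ∫ p : ℝ × (Fin n → ℝ) × Matrix (Fin n) (Fin d) ℝ × (Fin d → ℝ),
      p.1 ^ 2 * (sqnorm p.2.1 * frobSq (p.2.2.1 * p.2.2.1ᵀ)⁻¹) ∂dataLaw σ μA μx
      = σ ^ 2 * (n * σ ^ 2 * ∫ q, frobSq (q.1 * q.1ᵀ)⁻¹ ∂κ) := by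
    rw [integral_prod_mul (μ := θ) (fun a : ℝ => a ^ 2) fun q : (Fin n → ℝ) ×
        Matrix (Fin n) (Fin d) ℝ × (Fin d → ℝ) => sqnorm q.1 * frobSq (q.2.1 * q.2.1ᵀ)⁻¹,
      integral_prod_mul (ν := κ) sqnorm fun q => frobSq (q.1 * q.1ᵀ)⁻¹,
      integral_sq_gaussianReal, integral_sqnorm_gaussianVec]
  have e5 : ∫ p : ℝ × (Fin n → ℝ) × Matrix (Fin n) (Fin d) ℝ × (Fin d → ℝ),
      sqnorm p.2.1 ^ 2 * (frobSq (p.2.2.1 * p.2.2.1ᵀ)⁻¹ * sqnorm (dualSol p.2.2.1 p.2.2.2))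
        ∂dataLaw σ μA μx
      ≤ σ ^ 4 * (n ^ 2 * ∫ y, y ^ 4 ∂gaussianReal 0 1)
        * ∫ q, frobSq (q.1 * q.1ᵀ)⁻¹ * sqnorm (dualSol q.1 q.2) ∂κ := by
    have := integral_fun_snd (μ := θ) (ν := (gaussianVec n σ).prod κ)
      (f := fun q => sqnorm q.1 ^ 2 *
        (frobSq (q.2.1 * q.2.1ᵀ)⁻¹ * sqnorm (dualSol q.2.1 q.2.2)))
    rw [this, integral_prod_mul (ν := κ) (fun b => sqnorm b ^ 2) fun q =>
      frobSq (q.1 * q.1ᵀ)⁻¹ * sqnorm (dualSol q.1 q.2)]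
    simp only [probReal_univ, one_smul]
    exact mul_le_mul_of_nonneg_right (integral_sqnorm_sq_gaussianVec_le σ)
      (integral_nonneg fun q => mul_nonneg (frobSq_nonneg _) (sqnorm_nonneg _))
  have k1 : Integrable (fun p => sqnorm (dualSol p.2.2.1 p.2.2.2) + p.1 * f p.2)
    (dataLaw σ μA μx) := i1.add i2
  have k2 := k1.sub (i3.const_mul 2)
  have k3 := k2.add (i4.const_mul 2)
  have k4 := k3.add (i5.const_mul 4)
  refine (integral_mono_of_nonneg (ae_of_all _ fun _ => sqnorm_nonneg _) k4 ?_).trans ?_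
  · filter_upwards [ae_dataLaw_isUnit μA μx hli,
      (measurePreserving_fst.comp (measurePreserving_dataLaw μA μx σ)).quasiMeasurePreserving.ae hA]
      with p hp hpA
    exact sqnorm_dualSol_appendCol_le hpA hp _ _
  · rw [integral_add' k3 (i5.const_mul 4), integral_add' k2 (i4.const_mul 2),
      integral_sub' k1 (i3.const_mul 2), integral_add i1 i2, integral_const_mul, integral_const_mul,
      integral_const_mul, e1, e2, e3, e4]
    linarith

end Risk

lemma integrable_frobSq_gram_inv_mul {n d : ℕ} {μA : Measure (Matrix (Fin n) (Fin d) ℝ)}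
    {μx : Measure (Fin d → ℝ)} {g : Matrix (Fin n) (Fin d) ℝ × (Fin d → ℝ) → ℝ}
    (hg : Measurable g) (hg0 : ∀ q, 0 ≤ g q)
    (h : ∫⁻ q, ENNReal.ofReal (lambdaMax ((q.1 * q.1ᵀ)⁻¹) ^ 2 * g q) ∂μA.prod μx < ⊤) :
    Integrable (fun q => frobSq (q.1 * q.1ᵀ)⁻¹ * g q) (μA.prod μx) := by
  refine (lintegral_ofReal_ne_top_iff_integrable (Measurable.aestronglyMeasurable (by fun_prop))
    (ae_of_all _ fun q => mul_nonneg (frobSq_nonneg _) (hg0 q))).1 (ne_top_of_le_ne_top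
      (ENNReal.mul_ne_top (ENNReal.ofReal_ne_top (r := (n : ℝ) ^ 2)) h.ne) ?_)
  rw [← lintegral_const_mul' _ _ ENNReal.ofReal_ne_top]
  refine lintegral_mono fun q => ?_
  rw [← ENNReal.ofReal_mul (by positivity), ← mul_assoc]
  exact ENNReal.ofReal_le_ofReal (mul_le_mul_of_nonneg_right (frobSq_gram_inv_le q.1) (hg0 q))

/-- Theorem 9(b) of the paper: in the overparametrized regime with Gaussian
prior `[β; β₁] ~ N(0, ρ² I_{d+1})`, there is `σ > 0` such that adding a Gaussian `N(0,σ²)`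
feature decreases the expected risk, provided
`ρ ≤ η √(E‖(AᵀA)⁺x‖² / (E‖(A⁺)ᵀx‖² + 1))`. -/
theorem stmt18 (n d : ℕ) (hnd : n ≤ d) (η : ℝ) (hη : 0 < η)
    (μA : Measure (Matrix (Fin n) (Fin d) ℝ)) [IsProbabilityMeasure μA]
    (μx : Measure (Fin d → ℝ)) [IsProbabilityMeasure μx]
    (hli : ∀ σ : ℝ, 0 < σ →
      ∀ᵐ q : Matrix (Fin n) (Fin d) ℝ × (Fin n → ℝ)
          ∂μA.prod (Measure.pi fun _ : Fin n => gaussianReal 0 (σ ^ 2).toNNReal),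
        LinearIndependent ℝ (fun i => appendCol q.1 q.2 i))
    (hpos : 0 < ∫ q : Matrix (Fin n) (Fin d) ℝ × (Fin d → ℝ),
        sqnorm ((q.1ᵀ * ((q.1 * q.1ᵀ)⁻¹ ^ 2) * q.1) *ᵥ q.2) ∂μA.prod μx)
    (hfin1 : ∫⁻ q : Matrix (Fin n) (Fin d) ℝ × (Fin d → ℝ),
        ENNReal.ofReal (sqnorm ((pinvRows q.1)ᵀ *ᵥ q.2)) ∂μA.prod μx < ⊤)
    (hfin2 : ∫⁻ q : Matrix (Fin n) (Fin d) ℝ × (Fin d → ℝ),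
        ENNReal.ofReal (lambdaMax ((q.1 * q.1ᵀ)⁻¹) ^ 2) ∂μA.prod μx < ⊤)
    (hfin3 : ∫⁻ q : Matrix (Fin n) (Fin d) ℝ × (Fin d → ℝ),
        ENNReal.ofReal (lambdaMax ((q.1 * q.1ᵀ)⁻¹)
          * sqnorm ((pinvRows q.1)ᵀ *ᵥ q.2)) ∂μA.prod μx < ⊤)
    (hfin4 : ∫⁻ q : Matrix (Fin n) (Fin d) ℝ × (Fin d → ℝ),
        ENNReal.ofReal (lambdaMax ((q.1 * q.1ᵀ)⁻¹) ^ 2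
          * sqnorm ((pinvRows q.1)ᵀ *ᵥ q.2)) ∂μA.prod μx < ⊤) :
    ∃ σ : ℝ, 0 < σ ∧ ∀ ρ : ℝ, 0 < ρ →
      ρ ≤ η * Real.sqrt
          ((∫ q : Matrix (Fin n) (Fin d) ℝ × (Fin d → ℝ),
              sqnorm ((q.1ᵀ * ((q.1 * q.1ᵀ)⁻¹ ^ 2) * q.1) *ᵥ q.2) ∂μA.prod μx) /
            ((∫ q : Matrix (Fin n) (Fin d) ℝ × (Fin d → ℝ),
              sqnorm ((pinvRows q.1)ᵀ *ᵥ q.2) ∂μA.prod μx) + 1)) →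
      LexpD1 n d η (jointLaw n d ρ (gaussianReal 0 (σ ^ 2).toNNReal) μA μx)
        < LexpD n d η (jointLaw n d ρ (gaussianReal 0 (σ ^ 2).toNNReal) μA μx) := by
  simp only [pinvRows_transpose_mulVec, sqnorm_pinv_gram_mulVec] at hpos hfin1 hfin4 ⊢
  have hz : Integrable (fun q => sqnorm (dualSol q.1 q.2)) (μA.prod μx) :=
    (lintegral_ofReal_ne_top_iff_integrable (Measurable.aestronglyMeasurable (by fun_prop))
      (ae_of_all _ fun q => sqnorm_nonneg _)).1 hfin1.ne
  have hF : Integrable (fun q => frobSq (q.1 * q.1ᵀ)⁻¹) (μA.prod μx) := by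
    simpa using integrable_frobSq_gram_inv_mul (g := fun _ => 1) measurable_const
      (fun _ => zero_le_one) (by simpa using hfin2)
  have hFz := integrable_frobSq_gram_inv_mul
    (g := fun q : Matrix (Fin n) (Fin d) ℝ × (Fin d → ℝ) => sqnorm (dualSol q.1 q.2))
    (by fun_prop) (fun _ => sqnorm_nonneg _) hfin4
  have hZ0 : 0 ≤ ∫ q, sqnorm (dualSol q.1 q.2) ∂μA.prod μx :=
    integral_nonneg fun _ => sqnorm_nonneg _
  have hZ : 0 < ∫ q, sqnorm (dualSol q.1 q.2) ∂μA.prod μx := by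
    refine hZ0.lt_of_ne' fun h0 => hpos.ne' (integral_eq_zero_of_ae ?_)
    rw [integral_eq_zero_iff_of_nonneg (fun _ => sqnorm_nonneg _) hz] at h0
    filter_upwards [h0] with q hq
    simp [sqnorm_eq_zero.1 hq]
  have hB : 0 ≤ 2 * (n * ∫ q : Matrix (Fin n) (Fin d) ℝ × (Fin d → ℝ),
        frobSq (q.1 * q.1ᵀ)⁻¹ ∂μA.prod μx)
      + 4 * (n ^ 2 * (∫ y, y ^ 4 ∂gaussianReal 0 1)
        * ∫ q, frobSq (q.1 * q.1ᵀ)⁻¹ * sqnorm (dualSol q.1 q.2) ∂μA.prod μx) := by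
    have h1 : 0 ≤ ∫ q : Matrix (Fin n) (Fin d) ℝ × (Fin d → ℝ),
        frobSq (q.1 * q.1ᵀ)⁻¹ ∂μA.prod μx := integral_nonneg fun _ => frobSq_nonneg _
    have h2 : 0 ≤ ∫ q, frobSq (q.1 * q.1ᵀ)⁻¹ * sqnorm (dualSol q.1 q.2) ∂μA.prod μx :=
      integral_nonneg fun _ => mul_nonneg (frobSq_nonneg _) (sqnorm_nonneg _)
    have h3 : 0 ≤ ∫ y, y ^ 4 ∂gaussianReal 0 1 := integral_nonneg fun _ => by positivity
    positivity
  have hnoise := fun {σ : ℝ} hli hA => integral_sqnorm_dualSol_appendCol_le (σ := σ) (μx := μx)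
    hli hA hz hF hFz
  have hbias := fun {σ : ℝ} hli => integral_sqnorm_resid_appendCol_le (σ := σ) (μx := μx)
    hli hpos hz
  generalize 2 * (n * ∫ q : Matrix (Fin n) (Fin d) ℝ × (Fin d → ℝ),
      frobSq (q.1 * q.1ᵀ)⁻¹ ∂μA.prod μx) + 4 * (n ^ 2 * (∫ y, y ^ 4 ∂gaussianReal 0 1)
        * ∫ q, frobSq (q.1 * q.1ᵀ)⁻¹ * sqnorm (dualSol q.1 q.2) ∂μA.prod μx) = B at hB hnoise
  obtain ⟨σ, hσ, hσZ, hσB⟩ : ∃ σ : ℝ, 0 < σ ∧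
      σ ^ 2 * ∫ q, dualSol q.1 q.2 ⬝ᵥ ((q.1 * q.1ᵀ)⁻¹ *ᵥ dualSol q.1 q.2) ∂μA.prod μx
        < ∫ q, sqnorm (dualSol q.1 q.2) ∂μA.prod μx ∧
      σ ^ 2 * B
        < ∫ q, dualSol q.1 q.2 ⬝ᵥ ((q.1 * q.1ᵀ)⁻¹ *ᵥ dualSol q.1 q.2) ∂μA.prod μx := by
    generalize ∫ q, dualSol q.1 q.2 ⬝ᵥ ((q.1 * q.1ᵀ)⁻¹ *ᵥ dualSol q.1 q.2) ∂μA.prod μx = C at hpos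
    generalize ∫ q, sqnorm (dualSol q.1 q.2) ∂μA.prod μx = Z at hZ
    have hs : 0 < min (Z / (2 * C)) (C / (B + 1)) := by positivity
    refine ⟨√(min (Z / (2 * C)) (C / (B + 1))), Real.sqrt_pos.2 hs, ?_⟩
    rw [Real.sq_sqrt hs.le]
    have h1 := min_le_left (Z / (2 * C)) (C / (B + 1))
    have h2 := min_le_right (Z / (2 * C)) (C / (B + 1))
    rw [le_div_iff₀ (by positivity)] at h1 h2
    constructor <;> nlinarith
  refine ⟨σ, hσ, fun ρ hρ hle => ?_⟩
  rw [LexpD_jointLaw μA μx η σ hρ, LexpD1_jointLaw μA μx η σ hρ]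
  have hr := hbias (hli σ hσ)
  have hw : ∫ p, sqnorm (dualSol (appendCol p.2.2.1 p.2.1) (Fin.snoc p.2.2.2 p.1))
      ∂dataLaw σ μA μx < ∫ q, sqnorm (dualSol q.1 q.2) ∂μA.prod μx
        - σ ^ 2 * ∫ q, dualSol q.1 q.2 ⬝ᵥ ((q.1 * q.1ᵀ)⁻¹ *ᵥ dualSol q.1 q.2) ∂μA.prod μx := by
    by_cases hi : Integrable (fun p => sqnorm (dualSol (appendCol p.2.2.1 p.2.1)
        (Fin.snoc p.2.2.2 p.1))) (dataLaw σ μA μx)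
    · have h1 := hnoise (hli σ hσ)
        (ae_isUnit_of_integrable_sqnorm_dualSol_appendCol hσ (hli σ hσ) hi)
      nlinarith [mul_lt_mul_of_pos_left hσB (pow_pos hσ 2)]
    · rw [integral_undef hi]
      linarith
  generalize ∫ q, dualSol q.1 q.2 ⬝ᵥ ((q.1 * q.1ᵀ)⁻¹ *ᵥ dualSol q.1 q.2) ∂μA.prod μx = C at *
  generalize ∫ q, sqnorm (dualSol q.1 q.2) ∂μA.prod μx = Z at *
  have hρ2 : ρ ^ 2 * (1 + Z) ≤ η ^ 2 * C := by
    have h := pow_le_pow_left₀ hρ.le hle 2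
    rw [mul_pow, Real.sq_sqrt (by positivity), mul_div_assoc', le_div_iff₀ (by positivity)] at h
    linarith
  nlinarith [mul_le_mul_of_nonneg_left hr (sq_nonneg ρ), mul_lt_mul_of_pos_left hw (pow_pos hη 2),
    mul_le_mul_of_nonneg_left hρ2 (sq_nonneg σ)]

end
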